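/- Let n and m be unit vectors in a real inner product space E, with P := id − n⊗n and Q := id − m⊗m. Then P ∘ Q ∘ P − P = −(P m)⊗(P m); consequently, in operator norm, ‖P ∘ Q ∘ P − P‖ = ‖P m‖² ≤ ‖n − m‖². -/

import Mathlib

open scoped RealInnerProductSpace
open ContinuousLinearMap

/-- The rank-one operator `(u ⊗ w) v = ⟨w, v⟩ u`. -/
noncomputable def rankOne {E : Type*} [NormedAddCommGroup E] [InnerProductSpace ℝ E]
    (u w : E) : E →L[ℝ] E :=
  (innerSL ℝ w).smulRight u

/-- The orthogonal projection `id - u ⊗ u` onto `{u}ᗮ` (for `u` a unit vector). -/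
noncomputable def projPerp {E : Type*} [NormedAddCommGroup E] [InnerProductSpace ℝ E]
    (u : E) : E →L[ℝ] E :=
  ContinuousLinearMap.id ℝ E - rankOne u u

theorem rankOne_apply {E : Type*} [NormedAddCommGroup E] [InnerProductSpace ℝ E]
    (u w v : E) : rankOne u w v = ⟪w, v⟫ • u := rfl

theorem norm_rankOne {E : Type*} [NormedAddCommGroup E] [InnerProductSpace ℝ E]
    (u w : E) : ‖rankOne u w‖ = ‖u‖ * ‖w‖ :=
  InnerProductSpace.norm_rankOne u w

theorem projPerp_apply {E : Type*} [NormedAddCommGroup E] [InnerProductSpace ℝ E]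
    (u v : E) : projPerp u v = v - ⟪u, v⟫ • u := rfl

theorem projPerp_self {E : Type*} [NormedAddCommGroup E] [InnerProductSpace ℝ E]
    {u : E} (hu : ‖u‖ = 1) : projPerp u u = 0 := by
  simp [projPerp_apply, hu]

theorem projPerp_projPerp {E : Type*} [NormedAddCommGroup E] [InnerProductSpace ℝ E]
    {u : E} (hu : ‖u‖ = 1) (v : E) : projPerp u (projPerp u v) = projPerp u v := by
  rw [projPerp_apply u v, map_sub, map_smul, projPerp_self hu, smul_zero, sub_zero,
    projPerp_apply]

theorem inner_projPerp_left {E : Type*} [NormedAddCommGroup E] [InnerProductSpace ℝ E]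
    (u v w : E) : ⟪projPerp u v, w⟫ = ⟪v, projPerp u w⟫ := by
  simp only [projPerp_apply, inner_sub_left, inner_sub_right, real_inner_smul_left,
    real_inner_smul_right, real_inner_comm u v]
  ring

theorem norm_projPerp_apply_le {E : Type*} [NormedAddCommGroup E] [InnerProductSpace ℝ E]
    {u : E} (hu : ‖u‖ = 1) (v : E) : ‖projPerp u v‖ ≤ ‖v‖ := by
  have h : ‖projPerp u v‖ ^ 2 = ‖v‖ ^ 2 - ⟪u, v⟫ ^ 2 := by
    rw [← real_inner_self_eq_norm_sq, inner_projPerp_left, projPerp_projPerp hu,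
      projPerp_apply, inner_sub_right, real_inner_smul_right, real_inner_self_eq_norm_sq,
      real_inner_comm u v]
    ring
  refine (sq_le_sq₀ (norm_nonneg _) (norm_nonneg _)).1 ?_
  linarith [sq_nonneg ⟪u, v⟫]

theorem projPerp_comp_projPerp_comp_sub {E : Type*} [NormedAddCommGroup E]
    [InnerProductSpace ℝ E] {n : E} (hn : ‖n‖ = 1) (m : E) :
    projPerp n ∘L projPerp m ∘L projPerp n - projPerp n
      = -(rankOne (projPerp n m) (projPerp n m)) := by
  ext v
  simp only [sub_apply, comp_apply, neg_apply, rankOne_apply, inner_projPerp_left]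
  rw [projPerp_apply m, map_sub, map_smul, projPerp_projPerp hn]
  abel

/-- for unit vectors `n, m` with `P = id - n⊗n`, `Q = id - m⊗m`:
`P ∘ Q ∘ P - P = -(P m)⊗(P m)`, hence in operator norm
`‖P ∘ Q ∘ P - P‖ = ‖P m‖² ≤ ‖n - m‖²`. -/
theorem projection_sandwich_identity
    {E : Type*} [NormedAddCommGroup E] [InnerProductSpace ℝ E]
    (n m : E) (hn : ‖n‖ = 1) (hm : ‖m‖ = 1) :
    projPerp n ∘L projPerp m ∘L projPerp n - projPerp n
      = -(rankOne (projPerp n m) (projPerp n m)) ∧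
    ‖projPerp n ∘L projPerp m ∘L projPerp n - projPerp n‖ = ‖projPerp n m‖ ^ 2 ∧
    ‖projPerp n m‖ ^ 2 ≤ ‖n - m‖ ^ 2 := by
  have h := projPerp_comp_projPerp_comp_sub hn m
  refine ⟨h, by rw [h, norm_neg, norm_rankOne, sq], ?_⟩
  have hle := norm_projPerp_apply_le hn (n - m)
  rw [map_sub, projPerp_self hn, zero_sub, norm_neg] at hle
  gcongr
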